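/- Let G be the group presented by generators x₀,x₁,x₂,x₃,x₄ and relations [x₁,x₂] = [x₂,x₃] = [x₃,x₄] = [x₄,x₁] = 1, x₀² = 1, and x₀x_jx₀x_j = 1 for j = 1,2,3,4. Then: (a) the subgroup F₁₃ generated by {x₁,x₃} and the subgroup F₂₄ generated by {x₂,x₄} are free groups of rank 2, freely generated by these pairs; (b) the subgroup generated by {x₁,x₂,x₃,x₄} is the internal direct product of F₁₃ and F₂₄, hence isomorphic to the direct product of two free groups of rank 2; (c) the subgroups G₁₃ := ⟨x₀,x₁,x₃⟩ and G₂₄ := ⟨x₀,x₂,x₄⟩ are each isomorphic to the free product Z/2 * Z/2 * Z/2 of three cyclic groups of order 2; (d) F₂₄ is normal in G with G = F₂₄ ⋊ G₁₃, and F₁₃ is normal in G with G = F₁₃ ⋊ G₂₄. -/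

import Mathlib

/-- The relations `[x₁,x₂] = [x₂,x₃] = [x₃,x₄] = [x₄,x₁] = 1`, `x₀² = 1` and
`x₀xⱼx₀xⱼ = 1` (`j = 1,…,4`), where `[x,y] := x⁻¹y⁻¹xy`, on generators `x₀,…,x₄`. -/
def Grels : Set (FreeGroup (Fin 5)) :=
  { (FreeGroup.of 1)⁻¹ * (FreeGroup.of 2)⁻¹ * FreeGroup.of 1 * FreeGroup.of 2,
    (FreeGroup.of 2)⁻¹ * (FreeGroup.of 3)⁻¹ * FreeGroup.of 2 * FreeGroup.of 3,
    (FreeGroup.of 3)⁻¹ * (FreeGroup.of 4)⁻¹ * FreeGroup.of 3 * FreeGroup.of 4,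
    (FreeGroup.of 4)⁻¹ * (FreeGroup.of 1)⁻¹ * FreeGroup.of 4 * FreeGroup.of 1,
    FreeGroup.of 0 * FreeGroup.of 0,
    FreeGroup.of 0 * FreeGroup.of 1 * FreeGroup.of 0 * FreeGroup.of 1,
    FreeGroup.of 0 * FreeGroup.of 2 * FreeGroup.of 0 * FreeGroup.of 2,
    FreeGroup.of 0 * FreeGroup.of 3 * FreeGroup.of 0 * FreeGroup.of 3,
    FreeGroup.of 0 * FreeGroup.of 4 * FreeGroup.of 0 * FreeGroup.of 4 }

/-- The group `G = ⟨x₀,…,x₄ ∣ [x₁,x₂] = [x₂,x₃] = [x₃,x₄] = [x₄,x₁] = 1, x₀² = 1,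
(x₀xⱼ)² = 1⟩`. -/
abbrev GG : Type := PresentedGroup Grels

/-- The generator `xᵢ` of `GG`. -/
def x (i : Fin 5) : GG := PresentedGroup.of (rels := Grels) i

/-- The homomorphism of the free group on two generators into `GG` sending the two free
generators to `x₁` and `x₃`. -/
def ψ₁₃ : FreeGroup Bool →* GG := FreeGroup.lift (fun b => if b then x 3 else x 1)

/-- The homomorphism of the free group on two generators into `GG` sending the two free
generators to `x₂` and `x₄`. -/
def ψ₂₄ : FreeGroup Bool →* GG := FreeGroup.lift (fun b => if b then x 4 else x 2)

/-- The homomorphism `ℤ/2 → G` determined by an element `t` with `t * t = 1`. -/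
def involutionHom {G : Type*} [Group G] (t : G) (ht : t * t = 1) :
    Multiplicative (ZMod 2) →* G :=
  MonoidHom.mk' (fun z => t ^ z.toAdd.val) (by
    intro a b
    have h : ∀ m n : ZMod 2, t ^ (m + n).val = t ^ m.val * t ^ n.val := by
      intro m n
      rw [← pow_add, ZMod.val_add, ← pow_eq_pow_mod _ (by rw [pow_two, ht])]
    exact h a.toAdd b.toAdd)

@[simp] lemma involutionHom_ofAdd_one {G : Type*} [Group G] (t : G) (ht : t * t = 1) :
    involutionHom t ht (Multiplicative.ofAdd 1) = t :=
  pow_one t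

lemma ofAdd_one_mul_self :
    (Multiplicative.ofAdd 1 : Multiplicative (ZMod 2)) * Multiplicative.ofAdd 1 = 1 := by
  decide

lemma zmodTwo_hom_ext {G : Type*} [Group G] {f g : Multiplicative (ZMod 2) →* G}
    (h : f (Multiplicative.ofAdd 1) = g (Multiplicative.ofAdd 1)) : f = g := by
  refine MonoidHom.ext fun z => ?_
  have hz : z = 1 ∨ z = Multiplicative.ofAdd 1 := by revert z; decide
  rcases hz with rfl | rfl <;> simp [h]

lemma commute_freeGroup_lift {G : Type*} [Group G] {a : G} {c : Bool → G}
    (h : ∀ i, Commute a (c i)) (w : FreeGroup Bool) : Commute a (FreeGroup.lift c w) := by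
  have : FreeGroup.lift c = (MulAut.conj a).toMonoidHom.comp (FreeGroup.lift c) := by
    ext i; simp [(h i).eq]
  exact (eq_mul_inv_iff_mul_eq.1 (DFunLike.congr_fun this w)).symm

lemma freeGroup_lift_commute {G : Type*} [Group G] {c d : Bool → G}
    (hcd : ∀ i j, Commute (c i) (d j)) (v w : FreeGroup Bool) :
    Commute (FreeGroup.lift c v) (FreeGroup.lift d w) :=
  commute_freeGroup_lift
    (fun j => (commute_freeGroup_lift (fun i => (hcd i j).symm) v).symm) w

/-- The endomorphism of the free group of rank two inverting both generators. -/
def invertGens : FreeGroup Bool →* FreeGroup Bool :=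
  FreeGroup.lift fun i => (FreeGroup.of i)⁻¹

lemma invertGens_comp_self : invertGens.comp invertGens = MonoidHom.id _ := by
  ext i; simp [invertGens]

/-- The automorphism of the free group of rank two inverting both generators. -/
def invertGensAut : MulAut (FreeGroup Bool) :=
  MonoidHom.toMulEquiv invertGens invertGens invertGens_comp_self invertGens_comp_self

@[simp] lemma invertGensAut_of (i : Bool) :
    invertGensAut (FreeGroup.of i) = (FreeGroup.of i)⁻¹ := by
  simp [invertGensAut, invertGens]

lemma invertGensAut_mul_self : invertGensAut * invertGensAut = 1 :=
  MulEquiv.ext fun w => DFunLike.congr_fun invertGens_comp_self w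

/-- The semidirect product of the free group of rank two with `ℤ/2` acting by inversion of
the free generators. -/
abbrev FreeByInversion : Type :=
  FreeGroup Bool ⋊[involutionHom invertGensAut invertGensAut_mul_self] Multiplicative (ZMod 2)

namespace FreeByInversion

/-- The generator of the acting copy of `ℤ/2`. -/
def flip : FreeByInversion := SemidirectProduct.inr (Multiplicative.ofAdd 1)

/-- The free generators. -/
def gen (i : Bool) : FreeByInversion := SemidirectProduct.inl (FreeGroup.of i)

lemma flip_mul_self : flip * flip = 1 := by
  rw [flip, ← map_mul, ofAdd_one_mul_self, map_one]

lemma flip_mul_gen (i : Bool) : flip * gen i * flip * gen i = 1 := by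
  have h := SemidirectProduct.inl_aut
    (φ := involutionHom invertGensAut invertGensAut_mul_self)
    (Multiplicative.ofAdd 1) (FreeGroup.of i)
  have hf : (flip)⁻¹ = flip := inv_eq_of_mul_eq_one_left flip_mul_self
  rw [involutionHom_ofAdd_one, invertGensAut_of, map_inv, map_inv] at h
  change (gen i)⁻¹ = flip * gen i * flip⁻¹ at h
  rw [hf] at h
  rw [← h, inv_mul_cancel]

variable {G : Type*} [Group G]

lemma conj_lift_eq (t : G) (c : Bool → G) (ht : t * t = 1)
    (hc : ∀ i, t * c i * t * c i = 1) (w : FreeGroup Bool) :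
    FreeGroup.lift c (invertGensAut w) = t * FreeGroup.lift c w * t⁻¹ := by
  have h : (FreeGroup.lift c).comp invertGensAut.toMonoidHom =
      (MulAut.conj t).toMonoidHom.comp (FreeGroup.lift c) := by
    ext i
    have : t⁻¹ = t := inv_eq_of_mul_eq_one_left ht
    simpa [this] using (eq_inv_of_mul_eq_one_left (hc i)).symm
  exact DFunLike.congr_fun h w

/-- The homomorphism determined by the images of the flip and of the free generators. -/
def lift (t : G) (c : Bool → G) (ht : t * t = 1)
    (hc : ∀ i, t * c i * t * c i = 1) : FreeByInversion →* G :=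
  SemidirectProduct.lift (FreeGroup.lift c) (involutionHom t ht) (by
    intro z
    have hz : z = 1 ∨ z = Multiplicative.ofAdd 1 := by revert z; decide
    rcases hz with rfl | rfl
    · ext; simp
    · ext i
      simpa using conj_lift_eq t c ht hc (FreeGroup.of i))

section lift

variable (t : G) (c : Bool → G) (ht : t * t = 1) (hc : ∀ i, t * c i * t * c i = 1)

@[simp] lemma lift_flip : lift t c ht hc flip = t := by
  simp [lift, flip]

@[simp] lemma lift_gen (i : Bool) : lift t c ht hc (gen i) = c i := by
  simp [lift, gen]

end lift

lemma hom_ext {f g : FreeByInversion →* G} (h₀ : f flip = g flip)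
    (h : ∀ i, f (gen i) = g (gen i)) : f = g :=
  SemidirectProduct.hom_ext (FreeGroup.ext_hom _ _ fun i => h i) (zmodTwo_hom_ext h₀)

lemma closure_eq_top :
    Subgroup.closure {flip, gen false, gen true} = (⊤ : Subgroup FreeByInversion) := by
  set K := Subgroup.closure {flip, gen false, gen true} with hK
  have h₀ : flip ∈ K := Subgroup.subset_closure (by simp)
  have h₁ : ∀ i, gen i ∈ K := by
    rintro (_ | _) <;> exact Subgroup.subset_closure (by simp)
  let f : FreeByInversion →* K := lift ⟨flip, h₀⟩ (fun i => ⟨gen i, h₁ i⟩)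
    (Subtype.ext flip_mul_self) (fun i => Subtype.ext (flip_mul_gen i))
  have hf : K.subtype.comp f = MonoidHom.id _ := hom_ext (by simp [f]) (by simp [f])
  rw [eq_top_iff]
  intro y _
  have hy := DFunLike.congr_fun hf y
  rw [MonoidHom.id_apply] at hy
  exact hy ▸ (f y).2

lemma range_lift (t : G) (c : Bool → G) (ht : t * t = 1)
    (hc : ∀ i, t * c i * t * c i = 1) :
    (lift t c ht hc).range = Subgroup.closure {t, c false, c true} := by
  rw [MonoidHom.range_eq_map, ← closure_eq_top, MonoidHom.map_closure]
  simp [Set.image_insert_eq]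

open Monoid in
/-- `F₂ ⋊ ℤ/2` is the free product of three groups of order two. -/
def equivCoprodI :
    FreeByInversion ≃* CoprodI (fun _ : Fin 3 => Multiplicative (ZMod 2)) :=
  let u : Fin 3 → CoprodI (fun _ : Fin 3 => Multiplicative (ZMod 2)) :=
    fun i => CoprodI.of (i := i) (Multiplicative.ofAdd 1)
  have hu : ∀ i, u i * u i = 1 := fun i => by
    rw [← map_mul, ofAdd_one_mul_self, map_one]
  have hu' : ∀ i j, u i * (u i * j) = j := fun i j => by rw [← mul_assoc, hu, one_mul]
  have hflip : ∀ j, flip * (flip * j) = j := fun j => by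
    rw [← mul_assoc, flip_mul_self, one_mul]
  have hgen : ∀ i, flip * (gen i * (flip * gen i)) = 1 := fun i => by
    rw [← mul_assoc, ← mul_assoc, flip_mul_gen]
  let v : Fin 3 → FreeByInversion := ![flip, flip * gen false, flip * gen true]
  have hv : ∀ i, v i * v i = 1 := fun i => by
    fin_cases i <;> simp [v, flip_mul_self, mul_assoc, hgen]
  MonoidHom.toMulEquiv
    (lift (u 0) (fun i => u 0 * u (if i then 2 else 1)) (hu 0)
      (fun i => by simp [mul_assoc, hu, hu']))
    (CoprodI.lift fun i => involutionHom (v i) (hv i))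
    (hom_ext (by simp [u, v]) (by rintro (_ | _) <;> simp [u, v, hflip]))
    (CoprodI.ext_hom _ _ fun i => zmodTwo_hom_ext (by
      fin_cases i <;> simp [v, hu'] <;> rfl))

lemma leftInverse_lift {t : G} {c : Bool → G} {ht : t * t = 1}
    {hc : ∀ i, t * c i * t * c i = 1} {r : G →* FreeByInversion}
    (h₀ : r t = flip) (h : ∀ i, r (c i) = gen i) :
    Function.LeftInverse r (lift t c ht hc) := by
  have : r.comp (lift t c ht hc) = MonoidHom.id _ := hom_ext (by simp [h₀]) (by simp [h])
  exact DFunLike.congr_fun this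

/-- If the group `G` has a retraction sending `t, c false, c true` to the standard generators,
then they generate a free product of three groups of order two. -/
lemma nonempty_closure_equiv {t : G} {c : Bool → G} (ht : t * t = 1)
    (hc : ∀ i, t * c i * t * c i = 1) {r : G →* FreeByInversion}
    (h₀ : r t = flip) (h : ∀ i, r (c i) = gen i) :
    Nonempty (Subgroup.closure {t, c false, c true} ≃*
      Monoid.CoprodI (fun _ : Fin 3 => Multiplicative (ZMod 2))) := by
  rw [← range_lift t c ht hc]
  exact ⟨(MonoidHom.ofInjective
    (leftInverse_lift (ht := ht) (hc := hc) h₀ h).injective).symm.trans equivCoprodI⟩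

lemma freeGroup_lift_injective {c : Bool → G} {r : G →* FreeByInversion}
    (h : ∀ i, r (c i) = gen i) : Function.Injective (FreeGroup.lift c) := by
  have : r.comp (FreeGroup.lift c) = SemidirectProduct.inl := by
    ext i : 1; simp [h, gen]
  refine Function.Injective.of_comp (f := r) ?_
  rw [← MonoidHom.coe_comp, this]
  exact SemidirectProduct.inl_injective

lemma range_inf_closure_eq_bot {t : G} {c d : Bool → G} (ht : t * t = 1)
    (hc : ∀ i, t * c i * t * c i = 1) {r : G →* FreeByInversion}
    (h₀ : r t = flip) (h : ∀ i, r (c i) = gen i) (hd : ∀ i, r (d i) = 1) :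
    (FreeGroup.lift d).range ⊓ Subgroup.closure {t, c false, c true} = ⊥ := by
  rw [← range_lift t c ht hc, eq_bot_iff]
  rintro _ ⟨⟨w, hw⟩, ⟨y, rfl⟩⟩
  have hrd : r.comp (FreeGroup.lift d) = 1 := by ext i : 1; simp [hd]
  have hy : r (lift t c ht hc y) = 1 := by
    rw [← hw]; exact DFunLike.congr_fun hrd w
  rw [leftInverse_lift h₀ h] at hy
  simp [hy]

/-- The subgroup generated by the `d i` is normal when `G` is generated by these elements,
elements commuting with them, and an involution inverting them. -/
lemma range_normal {t : G} {c d : Bool → G} (ht : t * t = 1)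
    (hd : ∀ i, t * d i * t * d i = 1) (hcd : ∀ i j, Commute (c i) (d j))
    (hgen : Subgroup.closure ({t} ∪ Set.range c ∪ Set.range d) = ⊤) :
    (FreeGroup.lift d).range.Normal := by
  rw [← Subgroup.normalizer_eq_top_iff, eq_top_iff, ← hgen, Subgroup.closure_le]
  rintro g ((rfl | ⟨i, rfl⟩) | ⟨i, rfl⟩)
  · have key : ∀ y ∈ (FreeGroup.lift d).range, g * y * g⁻¹ ∈ (FreeGroup.lift d).range := by
      rintro _ ⟨w, rfl⟩
      exact ⟨invertGensAut w, conj_lift_eq g d ht hd w⟩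
    have hg : g⁻¹ = g := inv_eq_of_mul_eq_one_left ht
    refine Subgroup.mem_normalizer_iff.2 fun y => ⟨key y, fun hy => ?_⟩
    simpa [hg, mul_assoc, ht, ← mul_assoc g g] using key _ hy
  · refine Subgroup.centralizer_le_normalizer _ (Subgroup.mem_centralizer_iff.2 ?_)
    rintro _ ⟨w, rfl⟩
    exact (commute_freeGroup_lift (hcd i) w).symm
  · exact Subgroup.le_normalizer ⟨FreeGroup.of i, by simp⟩

end FreeByInversion

namespace GG

open FreeByInversion

/-- The generators `x₁, x₃`. -/
abbrev oddGen (i : Bool) : GG := if i then x 3 else x 1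

/-- The generators `x₂, x₄`. -/
abbrev evenGen (i : Bool) : GG := if i then x 4 else x 2

lemma mk_eq_one {r : FreeGroup (Fin 5)} (h : r ∈ Grels) :
    PresentedGroup.mk Grels r = 1 :=
  PresentedGroup.one_of_mem h

lemma x_zero_mul_self : x 0 * x 0 = 1 :=
  mk_eq_one (r := FreeGroup.of 0 * FreeGroup.of 0) (by simp [Grels])

lemma x_zero_oddGen (i : Bool) : x 0 * oddGen i * x 0 * oddGen i = 1 := by
  cases i
  · exact mk_eq_one
      (r := FreeGroup.of 0 * FreeGroup.of 1 * FreeGroup.of 0 * FreeGroup.of 1) (by simp [Grels])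
  · exact mk_eq_one
      (r := FreeGroup.of 0 * FreeGroup.of 3 * FreeGroup.of 0 * FreeGroup.of 3) (by simp [Grels])

lemma x_zero_evenGen (i : Bool) : x 0 * evenGen i * x 0 * evenGen i = 1 := by
  cases i
  · exact mk_eq_one
      (r := FreeGroup.of 0 * FreeGroup.of 2 * FreeGroup.of 0 * FreeGroup.of 2) (by simp [Grels])
  · exact mk_eq_one
      (r := FreeGroup.of 0 * FreeGroup.of 4 * FreeGroup.of 0 * FreeGroup.of 4) (by simp [Grels])

lemma commute_x {i j : Fin 5}
    (h : (FreeGroup.of i)⁻¹ * (FreeGroup.of j)⁻¹ * FreeGroup.of i * FreeGroup.of j ∈ Grels) :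
    Commute (x i) (x j) := by
  have h' : (x i)⁻¹ * (x j)⁻¹ * x i * x j = 1 := mk_eq_one h
  rw [mul_assoc, ← mul_inv_rev, inv_mul_eq_one] at h'
  exact h'.symm

lemma oddGen_commute_evenGen (i j : Bool) : Commute (oddGen i) (evenGen j) := by
  cases i <;> cases j
  · exact commute_x (i := 1) (j := 2) (by simp [Grels])
  · exact (commute_x (i := 4) (j := 1) (by simp [Grels])).symm
  · exact (commute_x (i := 2) (j := 3) (by simp [Grels])).symm
  · exact commute_x (i := 3) (j := 4) (by simp [Grels])

/-- The retraction of `G` killing `x₂` and `x₄`. -/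
def oddRetraction : GG →* FreeByInversion :=
  PresentedGroup.toGroup (f := ![flip, gen false, 1, gen true, 1]) (by
    intro r hr
    simp only [Grels, Set.mem_insert_iff, Set.mem_singleton_iff] at hr
    rcases hr with rfl | rfl | rfl | rfl | rfl | rfl | rfl | rfl | rfl <;>
      simp [flip_mul_self, flip_mul_gen])

/-- The retraction of `G` killing `x₁` and `x₃`. -/
def evenRetraction : GG →* FreeByInversion :=
  PresentedGroup.toGroup (f := ![flip, 1, gen false, 1, gen true]) (by
    intro r hr
    simp only [Grels, Set.mem_insert_iff, Set.mem_singleton_iff] at hr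
    rcases hr with rfl | rfl | rfl | rfl | rfl | rfl | rfl | rfl | rfl <;>
      simp [flip_mul_self, flip_mul_gen])

lemma oddRetraction_x (i : Fin 5) :
    oddRetraction (x i) = ![flip, gen false, 1, gen true, 1] i :=
  PresentedGroup.toGroup.of _

lemma evenRetraction_x (i : Fin 5) :
    evenRetraction (x i) = ![flip, 1, gen false, 1, gen true] i :=
  PresentedGroup.toGroup.of _

lemma oddRetraction_oddGen (i : Bool) : oddRetraction (oddGen i) = gen i := by
  cases i
  · exact oddRetraction_x 1
  · exact oddRetraction_x 3

lemma oddRetraction_evenGen (i : Bool) : oddRetraction (evenGen i) = 1 := by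
  cases i
  · exact oddRetraction_x 2
  · exact oddRetraction_x 4

lemma evenRetraction_evenGen (i : Bool) : evenRetraction (evenGen i) = gen i := by
  cases i
  · exact evenRetraction_x 2
  · exact evenRetraction_x 4

lemma evenRetraction_oddGen (i : Bool) : evenRetraction (oddGen i) = 1 := by
  cases i
  · exact evenRetraction_x 1
  · exact evenRetraction_x 3

lemma eq_top_of_forall_x_mem {K : Subgroup GG} (h : ∀ i, x i ∈ K) : K = ⊤ := by
  rw [eq_top_iff, ← PresentedGroup.closure_range_of Grels, Subgroup.closure_le]
  rintro _ ⟨i, rfl⟩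
  exact h i

lemma range_lift_pair (a b : GG) :
    (FreeGroup.lift fun i : Bool => if i then b else a).range = Subgroup.closure {a, b} := by
  rw [FreeGroup.range_lift_eq_closure]
  congr 1
  ext g
  simp [eq_comm]

lemma range_odd : ψ₁₃.range = Subgroup.closure {x 1, x 3} := range_lift_pair _ _

lemma range_even : ψ₂₄.range = Subgroup.closure {x 2, x 4} := range_lift_pair _ _

lemma closure_eq_sup :
    Subgroup.closure {x 1, x 2, x 3, x 4} = ψ₁₃.range ⊔ ψ₂₄.range := by
  rw [range_odd, range_even, ← Subgroup.closure_union]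
  congr 1
  ext g
  simp only [Set.mem_union, Set.mem_insert_iff, Set.mem_singleton_iff]
  tauto

lemma even_sup_eq_top : ψ₂₄.range ⊔ Subgroup.closure {x 0, x 1, x 3} = ⊤ := by
  rw [range_even, ← Subgroup.closure_union]
  refine eq_top_of_forall_x_mem fun i => Subgroup.subset_closure ?_
  fin_cases i <;> simp

lemma odd_sup_eq_top : ψ₁₃.range ⊔ Subgroup.closure {x 0, x 2, x 4} = ⊤ := by
  rw [range_odd, ← Subgroup.closure_union]
  refine eq_top_of_forall_x_mem fun i => Subgroup.subset_closure ?_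
  fin_cases i <;> simp

lemma even_inf_eq_bot : ψ₂₄.range ⊓ Subgroup.closure {x 0, x 1, x 3} = ⊥ :=
  range_inf_closure_eq_bot (c := oddGen) (d := evenGen) x_zero_mul_self x_zero_oddGen
    (oddRetraction_x 0) oddRetraction_oddGen oddRetraction_evenGen

lemma odd_inf_eq_bot : ψ₁₃.range ⊓ Subgroup.closure {x 0, x 2, x 4} = ⊥ :=
  range_inf_closure_eq_bot (c := evenGen) (d := oddGen) x_zero_mul_self x_zero_evenGen
    (evenRetraction_x 0) evenRetraction_evenGen evenRetraction_oddGen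

lemma odd_inf_even_eq_bot : ψ₁₃.range ⊓ ψ₂₄.range = ⊥ := by
  rw [eq_bot_iff, ← even_inf_eq_bot, inf_comm, range_odd]
  exact inf_le_inf_left _ (Subgroup.closure_mono (Set.subset_insert _ _))

lemma x_mem_generators (i : Fin 5) :
    x i ∈ Subgroup.closure ({x 0} ∪ Set.range oddGen ∪ Set.range evenGen) := by
  refine Subgroup.subset_closure ?_
  fin_cases i <;> simp

lemma even_normal : ψ₂₄.range.Normal :=
  range_normal x_zero_mul_self x_zero_evenGen oddGen_commute_evenGen
    (eq_top_of_forall_x_mem x_mem_generators)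

lemma odd_normal : ψ₁₃.range.Normal :=
  range_normal x_zero_mul_self x_zero_oddGen (fun i j => (oddGen_commute_evenGen j i).symm)
    (eq_top_of_forall_x_mem (by
      rw [Set.union_right_comm]; exact x_mem_generators))

lemma odd_injective : Function.Injective ψ₁₃ := freeGroup_lift_injective oddRetraction_oddGen

lemma even_injective : Function.Injective ψ₂₄ :=
  freeGroup_lift_injective evenRetraction_evenGen

lemma odd_commute_even (v w : FreeGroup Bool) : Commute (ψ₁₃ v) (ψ₂₄ w) :=
  freeGroup_lift_commute oddGen_commute_evenGen v w

lemma nonempty_closure_equiv_prod :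
    Nonempty (Subgroup.closure {x 1, x 2, x 3, x 4} ≃* FreeGroup Bool × FreeGroup Bool) := by
  have hinj : Function.Injective (ψ₁₃.noncommCoprod ψ₂₄ odd_commute_even) :=
    MonoidHom.noncommCoprod_injective _ _ _ |>.2
      ⟨odd_injective, even_injective, disjoint_iff.2 odd_inf_even_eq_bot⟩
  rw [closure_eq_sup, ← MonoidHom.noncommCoprod_range ψ₁₃ ψ₂₄ odd_commute_even]
  exact ⟨(MonoidHom.ofInjective hinj).symm⟩

end GG

/-- in `G = ⟨x₀,…,x₄ ∣ [x₁,x₂]=[x₂,x₃]=[x₃,x₄]=[x₄,x₁]=1, x₀²=1,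
x₀xⱼx₀xⱼ=1⟩`:
(a) the subgroups `F₁₃ = ⟨x₁,x₃⟩` and `F₂₄ = ⟨x₂,x₄⟩` are free of rank 2, freely
generated by these pairs (the maps `ψ₁₃`, `ψ₂₄` are injective);
(b) `⟨x₁,x₂,x₃,x₄⟩` is the internal direct product of `F₁₃` and `F₂₄`, hence isomorphic
to a direct product of two free groups of rank 2;
(c) `G₁₃ = ⟨x₀,x₁,x₃⟩` and `G₂₄ = ⟨x₀,x₂,x₄⟩` are each isomorphic to `ℤ/2 ∗ ℤ/2 ∗ ℤ/2`;
(d) `F₂₄ ⊴ G` with `G = F₂₄ ⋊ G₁₃`, and `F₁₃ ⊴ G` with `G = F₁₃ ⋊ G₂₄`. -/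
theorem stmt_9 :
    -- (a)
    (Function.Injective ψ₁₃ ∧ Function.Injective ψ₂₄) ∧
    -- (b)
    (Subgroup.closure {x 1, x 2, x 3, x 4} = ψ₁₃.range ⊔ ψ₂₄.range ∧
      ψ₁₃.range ⊓ ψ₂₄.range = ⊥ ∧
      (∀ a b : GG, a ∈ ψ₁₃.range → b ∈ ψ₂₄.range → a * b = b * a) ∧
      Nonempty (↥(Subgroup.closure {x 1, x 2, x 3, x 4}) ≃*
        FreeGroup Bool × FreeGroup Bool)) ∧
    -- (c)
    (Nonempty (↥(Subgroup.closure {x 0, x 1, x 3}) ≃*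
        Monoid.CoprodI (fun _ : Fin 3 => Multiplicative (ZMod 2))) ∧
      Nonempty (↥(Subgroup.closure {x 0, x 2, x 4}) ≃*
        Monoid.CoprodI (fun _ : Fin 3 => Multiplicative (ZMod 2)))) ∧
    -- (d)
    (ψ₂₄.range.Normal ∧ ψ₂₄.range ⊓ Subgroup.closure {x 0, x 1, x 3} = ⊥ ∧
        ψ₂₄.range ⊔ Subgroup.closure {x 0, x 1, x 3} = ⊤) ∧
    (ψ₁₃.range.Normal ∧ ψ₁₃.range ⊓ Subgroup.closure {x 0, x 2, x 4} = ⊥ ∧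
        ψ₁₃.range ⊔ Subgroup.closure {x 0, x 2, x 4} = ⊤) := by
  refine ⟨⟨GG.odd_injective, GG.even_injective⟩,
    ⟨GG.closure_eq_sup, GG.odd_inf_even_eq_bot, ?_, GG.nonempty_closure_equiv_prod⟩, ⟨?_, ?_⟩,
    ⟨GG.even_normal, GG.even_inf_eq_bot, GG.even_sup_eq_top⟩,
    GG.odd_normal, GG.odd_inf_eq_bot, GG.odd_sup_eq_top⟩
  · rintro _ _ ⟨v, rfl⟩ ⟨w, rfl⟩
    exact GG.odd_commute_even v w
  · exact FreeByInversion.nonempty_closure_equiv (c := GG.oddGen) GG.x_zero_mul_self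
      GG.x_zero_oddGen (GG.oddRetraction_x 0) GG.oddRetraction_oddGen
  · exact FreeByInversion.nonempty_closure_equiv (c := GG.evenGen) GG.x_zero_mul_self
      GG.x_zero_evenGen (GG.evenRetraction_x 0) GG.evenRetraction_evenGen
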